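/- Let q ≥ 1, T ≥ 1 and k ≥ 1 be integers with T ≤ n. Let u ∈ ℝ and let A be a real symmetric n×n matrix with A ≺ uI; let M̄ be a real symmetric positive semidefinite n×n matrix with M̄ ⪯ I and tr(M̄) ≤ T; and let C be a real symmetric positive definite k×k matrix. Then tr[(uI − A)^{-1} M̄] + tr[C^{-1}] ≤ (Σ_{i=n−T+1}^{n} (u − λ_i(A))^{-q} + tr[C^{-q}])^{1/q} · (T + k)^{1 − 1/q}. -/

import Mathlib

open Matrix

/- `sortedEig M i` is the `(i+1)`-st smallest eigenvalue `λ_{i+1}(M)` of a real symmetric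
matrix `M`, i.e. the eigenvalues listed in nondecreasing order; junk value `0` if `M` is not
symmetric. -/
open Classical in
noncomputable def sortedEig {n : ℕ} (M : Matrix (Fin n) (Fin n) ℝ) : Fin n → ℝ :=
  if h : M.IsHermitian then h.eigenvalues ∘ Tuple.sort h.eigenvalues else 0

theorem aux_spec {m : ℕ} (A : Matrix (Fin m) (Fin m) ℝ) (hA : A.IsHermitian) :
    ∃ U : Matrix (Fin m) (Fin m) ℝ, Uᴴ * U = 1 ∧ U * Uᴴ = 1 ∧
      A = U * diagonal hA.eigenvalues * Uᴴ := by
  refine ⟨hA.eigenvectorUnitary, ?_, ?_, ?_⟩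
  · exact Unitary.coe_star_mul_self hA.eigenvectorUnitary
  · exact Unitary.coe_mul_star_self hA.eigenvectorUnitary
  · exact hA.spectral_theorem

theorem aux_trace_pow {m : ℕ} (A : Matrix (Fin m) (Fin m) ℝ) (hA : A.IsHermitian) (q : ℕ) :
    (A ^ q).trace = ∑ i, hA.eigenvalues i ^ q := by
  obtain ⟨U, h1, h2, h3⟩ := aux_spec A hA
  generalize hA.eigenvalues = ev at *
  have h : ∀ q : ℕ, A ^ q = U * diagonal (fun i => ev i ^ q) * Uᴴ := by
    intro q
    induction q with
    | zero => simp only [pow_zero, diagonal_one, Matrix.mul_one, h2]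
    | succ p ih =>
      rw [pow_succ, ih]
      conv_lhs => rw [h3]
      calc _ = U * diagonal (fun i => ev i ^ p) * (Uᴴ * U) *
            diagonal ev * Uᴴ := by simp only [Matrix.mul_assoc]
        _ = _ := by
          rw [h1, Matrix.mul_one, Matrix.mul_assoc U, diagonal_mul_diagonal]
          simp only [pow_succ]
  rw [h, Matrix.trace_mul_comm, ← Matrix.mul_assoc, h1, Matrix.one_mul, trace_diagonal]

theorem aux_top {n T : ℕ} (hT1 : 1 ≤ T) (hTn : T ≤ n) (μ m : Fin n → ℝ) (hμ : Monotone μ)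
    (hpos : ∀ i, 0 < μ i) (h0 : ∀ i, 0 ≤ m i) (h1 : ∀ i, m i ≤ 1) (hs : ∑ i, m i ≤ T) :
    ∑ i, μ i * m i ≤ ∑ i ∈ Finset.univ.filter (fun i : Fin n => n - T ≤ (i : ℕ)), μ i := by
  obtain ⟨j, hj⟩ : ∃ j : Fin n, (j : ℕ) = n - T := ⟨⟨n - T, by omega⟩, rfl⟩
  have hcard : (Finset.univ.filter (fun i : Fin n => n - T ≤ (i : ℕ))).card = T := by
    have : (Finset.univ.filter (fun i : Fin n => n - T ≤ (i : ℕ))) = Finset.Ici j := by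
      ext i; simp [Fin.le_def, hj]
    rw [this, Fin.card_Ici]; omega
  have e1 : ∑ i, μ i * m i = ∑ i, (μ i - μ j) * m i + μ j * ∑ i, m i := by
    rw [Finset.mul_sum, ← Finset.sum_add_distrib]
    exact Finset.sum_congr rfl fun i _ => by ring
  have e2 : ∑ i ∈ Finset.univ.filter (fun i : Fin n => n - T ≤ (i : ℕ)), μ i =
      ∑ i ∈ Finset.univ.filter (fun i : Fin n => n - T ≤ (i : ℕ)), (μ i - μ j) + μ j * T := by
    rw [Finset.sum_sub_distrib, Finset.sum_const, hcard, nsmul_eq_mul]; ring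
  rw [e1, e2]
  refine add_le_add ?_ (mul_le_mul_of_nonneg_left hs (hpos j).le)
  rw [Finset.sum_filter]
  refine Finset.sum_le_sum fun i _ => ?_
  split_ifs with h
  · have : μ j ≤ μ i := hμ (by rw [Fin.le_def, hj]; exact h)
    nlinarith [h1 i]
  · have : μ i ≤ μ j := hμ (by rw [Fin.le_def, hj]; omega)
    nlinarith [h0 i]

theorem aux_holder {ι : Type*} (s : Finset ι) (f : ι → ℝ) (hf : ∀ i ∈ s, 0 ≤ f i) (q : ℕ)
    (hq : 1 ≤ q) (hs : 0 < s.card) :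
    ∑ i ∈ s, f i ≤ (∑ i ∈ s, f i ^ q) ^ ((1 : ℝ) / q) * (s.card : ℝ) ^ (1 - (1 : ℝ) / q) := by
  obtain ⟨p, rfl⟩ : ∃ p, q = p + 1 := ⟨q - 1, by omega⟩
  have h := pow_sum_div_card_le_sum_pow hf p
  have hc : (0 : ℝ) < s.card := by exact_mod_cast hs
  rw [div_le_iff₀ (by positivity)] at h
  have hS : 0 ≤ ∑ i ∈ s, f i := Finset.sum_nonneg hf
  have hS' : 0 ≤ ∑ i ∈ s, f i ^ (p + 1) := Finset.sum_nonneg fun i hi => pow_nonneg (hf i hi) _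
  have hp : ((p + 1 : ℕ) : ℝ) ≠ 0 := by positivity
  calc ∑ i ∈ s, f i = ((∑ i ∈ s, f i) ^ (p + 1)) ^ ((1 : ℝ) / (p + 1 : ℕ)) := by
        rw [one_div, Real.pow_rpow_inv_natCast hS (by omega)]
    _ ≤ ((∑ i ∈ s, f i ^ (p + 1)) * (s.card : ℝ) ^ p) ^ ((1 : ℝ) / (p + 1 : ℕ)) :=
        Real.rpow_le_rpow (by positivity) h (by positivity)
    _ = _ := by
        rw [Real.mul_rpow hS' (by positivity), ← Real.rpow_natCast_mul hc.le]
        congr 2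
        field_simp
        push_cast
        ring

/-- Let `q, T, k ≥ 1` with `T ≤ n`, let `A` be real symmetric with `A ≺ uI`,
let `M̄` be real symmetric PSD with `M̄ ⪯ I` and `tr(M̄) ≤ T`, and let `C` be real symmetric
positive definite of size `k × k`. Then
`tr[(uI − A)⁻¹ M̄] + tr[C⁻¹] ≤
  (Σ_{i = n−T+1}^{n} (u − λ_i(A))^{-q} + tr[C^{-q}])^{1/q} · (T + k)^{1 − 1/q}`. -/
theorem stmt_12 {n k : ℕ} (q T : ℕ) (hq : 1 ≤ q) (hT1 : 1 ≤ T) (hTn : T ≤ n)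
    (hk : 1 ≤ k)
    (u : ℝ) (A : Matrix (Fin n) (Fin n) ℝ) (hA : A.IsHermitian)
    (hAu : (u • (1 : Matrix (Fin n) (Fin n) ℝ) - A).PosDef)
    (M : Matrix (Fin n) (Fin n) ℝ) (hM : M.PosSemidef)
    (hMI : ((1 : Matrix (Fin n) (Fin n) ℝ) - M).PosSemidef)
    (htr : M.trace ≤ (T : ℝ))
    (C : Matrix (Fin k) (Fin k) ℝ) (hC : C.PosDef) :
    ((u • (1 : Matrix (Fin n) (Fin n) ℝ) - A)⁻¹ * M).trace + (C⁻¹).trace ≤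
      ((∑ i ∈ Finset.univ.filter (fun i : Fin n => n - T ≤ (i : ℕ)),
          1 / (u - sortedEig A i) ^ q) + ((C⁻¹) ^ q).trace) ^ ((1 : ℝ) / q) *
        ((T + k : ℕ) : ℝ) ^ (1 - (1 : ℝ) / q) := by
  obtain ⟨U, hU1, hU2, hU3⟩ := aux_spec A hA
  set lam := hA.eigenvalues with hlam
  have hdiag : Uᴴ * (u • (1 : Matrix (Fin n) (Fin n) ℝ) - A) * U =
      diagonal (fun i => u - lam i) := by
    have hAd : Uᴴ * A * U = diagonal lam := by
      conv_lhs => rw [hU3]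
      calc _ = (Uᴴ * U) * diagonal lam * (Uᴴ * U) := by simp only [Matrix.mul_assoc]
        _ = _ := by rw [hU1, Matrix.one_mul, Matrix.mul_one]
    rw [Matrix.mul_sub, Matrix.sub_mul, hAd]
    simp only [Matrix.mul_smul, Matrix.smul_mul, Matrix.mul_one, hU1]
    rw [smul_one_eq_diagonal, diagonal_sub]
  have hpos : ∀ i, 0 < u - lam i := by
    have hinj : Function.Injective U.mulVec := by
      intro x y hxy
      have := congrArg (Uᴴ.mulVec) hxy
      simpa only [Matrix.mulVec_mulVec, hU1, Matrix.one_mulVec] using this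
    have := hAu.conjTranspose_mul_mul_same hinj
    rw [hdiag] at this
    intro i
    simpa using this.diag_pos (i := i)
  have hinv : (u • (1 : Matrix (Fin n) (Fin n) ℝ) - A)⁻¹ =
      U * diagonal (fun i => 1 / (u - lam i)) * Uᴴ := by
    apply Matrix.inv_eq_right_inv
    have e : (u • (1 : Matrix (Fin n) (Fin n) ℝ) - A) =
        U * diagonal (fun i => u - lam i) * Uᴴ := by
      rw [← hdiag]
      calc _ = (U * Uᴴ) * (u • (1 : Matrix (Fin n) (Fin n) ℝ) - A) * (U * Uᴴ) := by
            rw [hU2, Matrix.one_mul, Matrix.mul_one]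
        _ = _ := by simp only [Matrix.mul_assoc]
    rw [e]
    calc _ = U * (diagonal (fun i => u - lam i) * ((Uᴴ * U) *
          diagonal (fun i => 1 / (u - lam i)))) * Uᴴ := by simp only [Matrix.mul_assoc]
      _ = 1 := by
        rw [hU1, Matrix.one_mul, diagonal_mul_diagonal]
        have : (fun i => (u - lam i) * (1 / (u - lam i))) = fun _ => 1 := by
          funext i
          exact mul_one_div_cancel (hpos i).ne'
        rw [this, diagonal_one, Matrix.mul_one, hU2]
  set N := Uᴴ * M * U with hN
  have hN0 : ∀ i, 0 ≤ N i i := fun i => (hM.conjTranspose_mul_mul_same U).diag_nonneg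
  have hN1 : ∀ i, N i i ≤ 1 := by
    intro i
    have := (hMI.conjTranspose_mul_mul_same U).diag_nonneg (i := i)
    rw [Matrix.mul_sub, Matrix.sub_mul, Matrix.mul_one, hU1, ← hN] at this
    simpa using this
  have hNt : ∑ i, N i i ≤ T := by
    have : N.trace = M.trace := by
      rw [hN, Matrix.trace_mul_comm, ← Matrix.mul_assoc, hU2, Matrix.one_mul]
    rw [← this] at htr
    exact htr
  have htrace : ((u • (1 : Matrix (Fin n) (Fin n) ℝ) - A)⁻¹ * M).trace =
      ∑ i, 1 / (u - lam i) * N i i := by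
    rw [hinv, Matrix.mul_assoc, Matrix.mul_assoc, Matrix.trace_mul_comm, Matrix.mul_assoc,
      ← hN]
    simp [Matrix.trace, Matrix.diagonal_mul]
  have hsort : ∀ i, sortedEig A i = lam (Tuple.sort lam i) := by
    intro i
    rw [sortedEig, dif_pos hA]
    rfl
  have hmono : Monotone (fun i => 1 / (u - sortedEig A i)) := by
    intro i j hij
    have := Tuple.monotone_sort lam hij
    simp only [Function.comp_apply] at this
    simp only [hsort]
    exact one_div_le_one_div_of_le (hpos _) (by linarith)
  have hpos' : ∀ i, 0 < 1 / (u - sortedEig A i) := fun i => by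
    rw [hsort]; exact one_div_pos.mpr (hpos _)
  have htop := aux_top hT1 hTn (fun i => 1 / (u - sortedEig A i))
    (fun i => N (Tuple.sort lam i) (Tuple.sort lam i)) hmono hpos' (fun i => hN0 _)
    (fun i => hN1 _) (by
      rw [Equiv.sum_comp (Tuple.sort lam) (fun i => N i i)]; exact hNt)
  have hre : ∑ i, 1 / (u - sortedEig A i) * N (Tuple.sort lam i) (Tuple.sort lam i) =
      ∑ i, 1 / (u - lam i) * N i i := by
    simp only [hsort]
    exact Equiv.sum_comp (Tuple.sort lam) (fun i => 1 / (u - lam i) * N i i)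
  rw [hre, ← htrace] at htop
  have hCi := hC.inv
  have hc := fun i => hCi.eigenvalues_pos i
  have ht1 := aux_trace_pow C⁻¹ hCi.1 1
  have htq := aux_trace_pow C⁻¹ hCi.1 q
  simp only [pow_one] at ht1
  set S := Finset.univ.filter (fun i : Fin n => n - T ≤ (i : ℕ)) with hS
  have hcard : S.card = T := by
    obtain ⟨j, hj⟩ : ∃ j : Fin n, (j : ℕ) = n - T := ⟨⟨n - T, by omega⟩, rfl⟩
    have : S = Finset.Ici j := by
      ext i; simp [hS, Fin.le_def, hj]
    rw [this, Fin.card_Ici]; omega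
  have hh := aux_holder (S.disjSum (Finset.univ : Finset (Fin k)))
    (Sum.elim (fun i => 1 / (u - sortedEig A i)) hCi.1.eigenvalues) (by
      rintro (i | i) _
      · exact (hpos' i).le
      · exact (hc i).le) q hq (by rw [Finset.card_disjSum, hcard]; omega)
  rw [Finset.card_disjSum, hcard, Finset.sum_disjSum, Finset.sum_disjSum] at hh
  simp only [Sum.elim_inl, Sum.elim_inr, Finset.card_univ, Fintype.card_fin, _root_.one_div_pow] at hh
  rw [htq, ht1]
  exact le_trans (add_le_add htop le_rfl) hh
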